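/- There is no voting method on the domain of all profiles with at most 4 candidates that is anonymous, neutral, homogeneous, and cancellative and satisfies binary γ and weak quasi-resoluteness. -/

import Mathlib

/- Formalization of voting-theoretic notions from Holliday, Norman, Pacuit, Zahedian,
"Impossibility theorems involving weakenings of expansion consistency and resoluteness
in voting". Candidates form an infinite type `C` and voters an infinite type `V`. -/

open Classical

noncomputable section

/-- `L` is a strict linear order on exactly the finite set `s`. -/
def IsStrictLinearOrderOn {C : Type} (s : Finset C) (L : C → C → Prop) : Prop :=
  (∀ x, ¬ L x x) ∧ (∀ x y z, L x y → L y z → L x z) ∧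
    (∀ x ∈ s, ∀ y ∈ s, x ≠ y → L x y ∨ L y x) ∧ ∀ x y, L x y → x ∈ s ∧ y ∈ s

/-- Restriction of a relation to a finite set `A`. -/
def restrictRel {C : Type} (A : Finset C) (L : C → C → Prop) : C → C → Prop :=
  fun x y => L x y ∧ x ∈ A ∧ y ∈ A

theorem IsStrictLinearOrderOn.restrict {C : Type} {s A : Finset C} {L : C → C → Prop}
    (h : IsStrictLinearOrderOn s L) (hA : A ⊆ s) :
    IsStrictLinearOrderOn A (restrictRel A L) := by
  obtain ⟨hirr, htr, htot, hdom⟩ := h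
  refine ⟨fun x hx => hirr x hx.1,
    fun x y z hxy hyz => ⟨htr _ _ _ hxy.1 hyz.1, hxy.2.1, hyz.2.2⟩, ?_,
    fun x y hxy => ⟨hxy.2.1, hxy.2.2⟩⟩
  intro x hx y hy hne
  rcases htot x (hA hx) y (hA hy) hne with h' | h'
  · exact Or.inl ⟨h', hx, hy⟩
  · exact Or.inr ⟨h', hy, hx⟩

/-- The image of a relation under the transposition of `a` and `b`. -/
def swapRel {C : Type} (a b : C) (L : C → C → Prop) : C → C → Prop :=
  fun x y => L (Equiv.swap a b x) (Equiv.swap a b y)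

theorem IsStrictLinearOrderOn.swapRel_mem {C : Type} {s : Finset C} {L : C → C → Prop}
    (a b : C) (h : IsStrictLinearOrderOn s L) :
    IsStrictLinearOrderOn (s.image (Equiv.swap a b)) (swapRel a b L) := by
  obtain ⟨hirr, htr, htot, hdom⟩ := h
  refine ⟨fun x => hirr _, fun x y z hxy hyz => htr _ _ _ hxy hyz, ?_, ?_⟩
  · intro x hx y hy hne
    obtain ⟨x', hx', rfl⟩ := Finset.mem_image.mp hx
    obtain ⟨y', hy', rfl⟩ := Finset.mem_image.mp hy
    have hne' : x' ≠ y' := by rintro rfl; exact hne rfl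
    have := htot x' hx' y' hy' hne'
    simpa [swapRel, Equiv.swap_apply_self] using this
  · intro x y hxy
    obtain ⟨h1, h2⟩ := hdom _ _ hxy
    exact ⟨Finset.mem_image.mpr ⟨_, h1, Equiv.swap_apply_self a b x⟩,
      Finset.mem_image.mpr ⟨_, h2, Equiv.swap_apply_self a b y⟩⟩

/-- A preference profile: each voter in the finite set `voters` submits a strict linear
order of the finite nonempty set `cands` of candidates. -/
structure Profile (C V : Type) where
  voters : Finset V
  cands : Finset C
  cands_nonempty : cands.Nonempty
  ballot : V → C → C → Prop
  ballot_lin : ∀ i ∈ voters, IsStrictLinearOrderOn cands (ballot i)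

namespace Profile

variable {C V : Type}

/-- The margin of `x` over `y` in `P`: the number of voters ranking `x` above `y`
minus the number of voters ranking `y` above `x`. -/
def margin (P : Profile C V) (x y : C) : ℤ :=
  ((P.voters.filter (fun i => P.ballot i x y)).card : ℤ) -
    ((P.voters.filter (fun i => P.ballot i y x)).card : ℤ)

/-- The profile `P^{i⇄j}` obtained by transposing the voters `i` and `j`. -/
def swapVoters (P : Profile C V) (i j : V) : Profile C V where
  voters := P.voters.image (Equiv.swap i j)
  cands := P.cands
  cands_nonempty := P.cands_nonempty
  ballot := fun k => P.ballot (Equiv.swap i j k)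
  ballot_lin := by
    intro k hk
    obtain ⟨m, hm, rfl⟩ := Finset.mem_image.mp hk
    simpa [Equiv.swap_apply_self] using P.ballot_lin m hm

/-- The profile `P_{a⇄b}` obtained by transposing the candidates `a` and `b`. -/
def swapCands (P : Profile C V) (a b : C) : Profile C V where
  voters := P.voters
  cands := P.cands.image (Equiv.swap a b)
  cands_nonempty := P.cands_nonempty.image _
  ballot := fun i => swapRel a b (P.ballot i)
  ballot_lin := fun i hi => (P.ballot_lin i hi).swapRel_mem a b

/-- The restriction `P|_A` of a profile to a nonempty subset `A` of its candidates. -/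
def restrict (P : Profile C V) (A : Finset C) (hA : A.Nonempty) (hsub : A ⊆ P.cands) :
    Profile C V where
  voters := P.voters
  cands := A
  cands_nonempty := hA
  ballot := fun i => restrictRel A (P.ballot i)
  ballot_lin := fun i hi => (P.ballot_lin i hi).restrict hsub

/-- The profile `P_{-y}`, i.e. `P` with the candidate `y` removed. -/
def minus (P : Profile C V) (y : C) (h : (P.cands.erase y).Nonempty) : Profile C V :=
  P.restrict (P.cands.erase y) h (P.cands.erase_subset y)

/-- The profile `P|_{{x,y}}`, i.e. `P` restricted to the two candidates `x` and `y`. -/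
def pair (P : Profile C V) (x y : C) (hx : x ∈ P.cands) (hy : y ∈ P.cands) : Profile C V :=
  P.restrict {x, y} ⟨x, Finset.mem_insert_self x {y}⟩
    (by
      intro z hz
      rcases Finset.mem_insert.mp hz with rfl | hz
      · exact hx
      · rcases Finset.mem_singleton.mp hz with rfl
        exact hy)

/-- `P` is uniquely weighted: no two distinct ordered pairs of distinct candidates
have the same margin. -/
def UniquelyWeighted (P : Profile C V) : Prop :=
  ∀ a ∈ P.cands, ∀ b ∈ P.cands, ∀ x ∈ P.cands, ∀ y ∈ P.cands,
    a ≠ b → x ≠ y → (a, b) ≠ (x, y) → P.margin a b ≠ P.margin x y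

/-- `P` is uniquely ranked: in every subelection with at least two candidates, no two
candidates have the same number of `n`-th place votes, and no two candidates have the
same Borda score. -/
def UniquelyRanked (P : Profile C V) : Prop :=
  ∀ Y ⊆ P.cands, 2 ≤ Y.card →
    ((∀ n : ℕ, 1 ≤ n → n ≤ Y.card → ∀ x ∈ Y, ∀ y ∈ Y, x ≠ y →
        (P.voters.filter
            (fun i => (Y.filter (fun z => P.ballot i z x)).card = n - 1)).card ≠
          (P.voters.filter
            (fun i => (Y.filter (fun z => P.ballot i z y)).card = n - 1)).card) ∧
      (∀ x ∈ Y, ∀ y ∈ Y, x ≠ y →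
        (∑ i ∈ P.voters, (Y.filter (fun z => P.ballot i x z)).card) ≠
          ∑ i ∈ P.voters, (Y.filter (fun z => P.ballot i y z)).card))

/-- `Q` is an `n`-fold copy `nP` of `P`: same candidates, and there is a map sending
the voters of `Q` onto the voters of `P` such that each voter of `P` has exactly `n`
preimages, each with the same ballot. -/
def IsCopy (Q P : Profile C V) (n : ℕ) : Prop :=
  Q.cands = P.cands ∧
    ∃ h : V → V,
      (∀ j ∈ Q.voters, h j ∈ P.voters) ∧
      (∀ i ∈ P.voters, (Q.voters.filter (fun j => h j = i)).card = n) ∧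
      (∀ j ∈ Q.voters, Q.ballot j = P.ballot (h j))

/-- `Q` is obtained from `P` by deleting one voter with each linear order of the
candidates of `P`. -/
def IsCancelOf (Q P : Profile C V) : Prop :=
  Q.cands = P.cands ∧ Q.voters ⊆ P.voters ∧
    (∀ j ∈ Q.voters, Q.ballot j = P.ballot j) ∧
    ∀ L : C → C → Prop, IsStrictLinearOrderOn P.cands L →
      ((P.voters \ Q.voters).filter (fun i => P.ballot i = L)).card = 1

end Profile

/-- A voting method: a function assigning to each profile in a nonempty domain a
nonempty set of winners among its candidates. -/
structure VotingMethod (C V : Type) where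
  dom : Set (Profile C V)
  dom_nonempty : dom.Nonempty
  winners : Profile C V → Finset C
  winners_nonempty : ∀ P ∈ dom, (winners P).Nonempty
  winners_sub : ∀ P ∈ dom, winners P ⊆ P.cands

namespace VotingMethod

variable {C V : Type}

/-- Anonymity: transposing two voters does not change the winners. -/
def Anonymous (F : VotingMethod C V) : Prop :=
  ∀ P ∈ F.dom, ∀ i j : V, P.swapVoters i j ∈ F.dom →
    F.winners (P.swapVoters i j) = F.winners P

/-- Neutrality: transposing two candidates transposes the winners accordingly. -/
def Neutral (F : VotingMethod C V) : Prop :=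
  ∀ P ∈ F.dom, ∀ a b : C, P.swapCands a b ∈ F.dom →
    F.winners (P.swapCands a b) = (F.winners P).image (Equiv.swap a b)

/-- Binary resoluteness: a unique winner in any two-candidate profile. -/
def BinaryResolute (F : VotingMethod C V) : Prop :=
  ∀ P ∈ F.dom, P.cands.card = 2 → (F.winners P).card = 1

/-- Binary quasi-resoluteness: a unique winner in any two-candidate profile whose
two distinct candidates have a nonzero margin between them. -/
def BinaryQuasiResolute (F : VotingMethod C V) : Prop :=
  ∀ P ∈ F.dom, P.cands.card = 2 →
    (∀ x ∈ P.cands, ∀ y ∈ P.cands, x ≠ y → P.margin x y ≠ 0) →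
    (F.winners P).card = 1

/-- Quasi-resoluteness: a unique winner in any uniquely weighted profile. -/
def QuasiResolute (F : VotingMethod C V) : Prop :=
  ∀ P ∈ F.dom, P.UniquelyWeighted → (F.winners P).card = 1

/-- Weak quasi-resoluteness: a unique winner in any profile that is both uniquely
weighted and uniquely ranked. -/
def WeakQuasiResolute (F : VotingMethod C V) : Prop :=
  ∀ P ∈ F.dom, P.UniquelyWeighted → P.UniquelyRanked → (F.winners P).card = 1

/-- Binary γ: if `x` wins without `y` and wins the head-to-head against `y`,
then `x` wins with `y` included. -/
def BinaryGamma (F : VotingMethod C V) : Prop :=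
  ∀ P ∈ F.dom, ∀ x, ∀ hx : x ∈ P.cands, ∀ y, ∀ hy : y ∈ P.cands, x ≠ y →
    ∀ h : (P.cands.erase y).Nonempty,
      P.minus y h ∈ F.dom → P.pair x y hx hy ∈ F.dom →
      x ∈ F.winners (P.minus y h) → F.winners (P.pair x y hx hy) = {x} →
      x ∈ F.winners P

/-- α-resoluteness: if `x` wins without `y` and wins the head-to-head against `y`,
then adding `y` does not enlarge the set of winners. -/
def AlphaResolute (F : VotingMethod C V) : Prop :=
  ∀ P ∈ F.dom, ∀ x, ∀ hx : x ∈ P.cands, ∀ y, ∀ hy : y ∈ P.cands, x ≠ y →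
    ∀ h : (P.cands.erase y).Nonempty,
      P.minus y h ∈ F.dom → P.pair x y hx hy ∈ F.dom →
      x ∈ F.winners (P.minus y h) → F.winners (P.pair x y hx hy) = {x} →
      (F.winners P).card ≤ (F.winners (P.minus y h)).card

/-- Homogeneity: replacing each voter by `n` copies of that voter does not change
the winners. -/
def Homogeneous (F : VotingMethod C V) : Prop :=
  ∀ P ∈ F.dom, ∀ Q ∈ F.dom, ∀ n : ℕ, 0 < n → Q.IsCopy P n → F.winners Q = F.winners P

/-- Cancellativity: deleting one voter with each linear order of the candidates does
not change the winners. -/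
def Cancellative (F : VotingMethod C V) : Prop :=
  ∀ P ∈ F.dom, ∀ Q ∈ F.dom, Q.IsCancelOf P → F.winners Q = F.winners P

/-- Majoritarianism: the winners depend only on the majority graph of the profile. -/
def Majoritarian (F : VotingMethod C V) : Prop :=
  ∀ P ∈ F.dom, ∀ P' ∈ F.dom, P.cands = P'.cands →
    (∀ x ∈ P.cands, ∀ y ∈ P.cands, (0 < P.margin x y ↔ 0 < P'.margin x y)) →
    F.winners P = F.winners P'

/-- Pairwiseness: the winners depend only on the margin graph of the profile. -/
def Pairwise (F : VotingMethod C V) : Prop :=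
  ∀ P ∈ F.dom, ∀ P' ∈ F.dom, P.cands = P'.cands →
    (∀ x ∈ P.cands, ∀ y ∈ P.cands, P.margin x y = P'.margin x y) →
    F.winners P = F.winners P'

end VotingMethod

/-! ### Proof -/

namespace NHC

variable {C V : Type}

/-- number of voters with ballot `L` -/
def cnt (P : Profile C V) (L : C → C → Prop) : ℕ :=
  (P.voters.filter (fun i => P.ballot i = L)).card

theorem exists_fiber_map (A B : Finset V) (n : ℕ) (h : A.card = n * B.card) :
    ∃ f : V → V, (∀ j ∈ A, f j ∈ B) ∧ ∀ i ∈ B, (A.filter (fun j => f j = i)).card = n := by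
  have hc : Fintype.card A = Fintype.card (Fin n × B) := by simp [h]
  let e : A ≃ Fin n × B := Fintype.equivOfCardEq hc
  refine ⟨fun j => if hj : j ∈ A then ((e ⟨j, hj⟩).2 : V) else j, ?_, ?_⟩
  · intro j hj
    simp [hj]
  · intro i hi
    have : (Finset.univ : Finset (Fin n)).card = n := by simp
    refine Eq.trans (Eq.symm ?_) this
    refine Finset.card_bij (fun t _ => ((e.symm (t, ⟨i, hi⟩) : A) : V)) ?_ ?_ ?_
    · intro t _
      simp
    · intro t _ t' _ htt
      have := e.symm.injective (Subtype.ext htt)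
      exact (Prod.mk.inj this).1
    · intro j hj
      rw [Finset.mem_filter] at hj
      obtain ⟨hjA, hj⟩ := hj
      simp only [hjA, dif_pos] at hj
      refine ⟨(e ⟨j, hjA⟩).1, Finset.mem_univ _, ?_⟩
      have : ((e ⟨j, hjA⟩).1, (⟨i, hi⟩ : B)) = e ⟨j, hjA⟩ :=
        Prod.ext rfl (Subtype.ext hj.symm)
      rw [this]
      simp

theorem isCopy_of_cnt (P Q : Profile C V) (n : ℕ) (hc : Q.cands = P.cands)
    (h : ∀ L, cnt Q L = n * cnt P L) : Q.IsCopy P n := by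
  refine ⟨hc, ?_⟩
  choose f hf1 hf2 using fun L => exists_fiber_map _ _ n (h L)
  have key : ∀ j ∈ Q.voters, f (Q.ballot j) j ∈ P.voters ∧
      P.ballot (f (Q.ballot j) j) = Q.ballot j := by
    intro j hj
    have := hf1 (Q.ballot j) j (by simp [hj])
    simpa using this
  refine ⟨fun j => f (Q.ballot j) j, fun j hj => (key j hj).1, ?_, fun j hj => (key j hj).2.symm⟩
  intro i hi
  rw [← hf2 (P.ballot i) i (by simp [hi])]
  congr 1
  ext j
  simp only [Finset.mem_filter]
  constructor
  · rintro ⟨hj, rfl⟩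
    refine ⟨⟨hj, (key j hj).2.symm⟩, ?_⟩
    rw [(key j hj).2]
  · rintro ⟨⟨hj, hb⟩, hji⟩
    exact ⟨hj, by rw [hb]; exact hji⟩

theorem exists_cancel [Nonempty V] (P : Profile C V)
    (h : ∀ L, IsStrictLinearOrderOn P.cands L → 0 < cnt P L) :
    ∃ Q : Profile C V, Q.IsCancelOf P ∧
      ∀ L, IsStrictLinearOrderOn P.cands L → cnt P L = cnt Q L + 1 := by
  have h' : ∀ L, IsStrictLinearOrderOn P.cands L → ∃ i, i ∈ P.voters ∧ P.ballot i = L := by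
    intro L hL
    obtain ⟨i, hi⟩ := Finset.card_pos.mp (h L hL)
    exact ⟨i, by simpa using hi⟩
  choose! v hv1 hv2 using h'
  have hsub : P.voters.filter (fun i => ¬ i = v (P.ballot i)) ⊆ P.voters :=
    Finset.filter_subset _ _
  let Q : Profile C V :=
    { voters := P.voters.filter (fun i => ¬ i = v (P.ballot i))
      cands := P.cands
      cands_nonempty := P.cands_nonempty
      ballot := P.ballot
      ballot_lin := fun i hi => P.ballot_lin i (hsub hi) }
  have hone : ∀ L, IsStrictLinearOrderOn P.cands L →
      ((P.voters \ Q.voters).filter (fun i => P.ballot i = L)).card = 1 := by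
    intro L hL
    rw [Finset.card_eq_one]
    refine ⟨v L, ?_⟩
    ext i
    simp only [Q, Finset.mem_filter, Finset.mem_sdiff, Finset.mem_singleton]
    constructor
    · rintro ⟨⟨hi, hn⟩, rfl⟩
      by_contra hne
      exact hn ⟨hi, hne⟩
    · rintro rfl
      refine ⟨⟨hv1 L hL, ?_⟩, hv2 L hL⟩
      rintro ⟨_, hn⟩
      rw [hv2 L hL] at hn
      exact hn rfl
  refine ⟨Q, ⟨rfl, hsub, fun _ _ => rfl, hone⟩, ?_⟩
  intro L hL
  rw [← hone L hL]
  unfold cnt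
  rw [← Finset.card_union_of_disjoint]
  · congr 1
    ext i
    simp only [Q, Finset.mem_filter, Finset.mem_sdiff, Finset.mem_union]
    tauto
  · rw [Finset.disjoint_left]
    intro i hi hi'
    simp only [Finset.mem_filter, Finset.mem_sdiff] at hi hi'
    exact hi'.1.2 hi.1

theorem cnt_eq_zero (P : Profile C V) (L : C → C → Prop)
    (h : ¬ IsStrictLinearOrderOn P.cands L) : cnt P L = 0 := by
  unfold cnt
  rw [Finset.card_eq_zero, Finset.filter_eq_empty_iff]
  rintro i hi rfl
  exact h (P.ballot_lin i hi)

theorem transfer [Nonempty V] (F : VotingMethod C V)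
    (hdom : F.dom = {P : Profile C V | P.cands.card ≤ 4})
    (hH : F.Homogeneous) (hC : F.Cancellative) (Q : Profile C V) (hQ : Q.cands.card ≤ 4)
    (n : ℕ) (hn : 0 < n) (k : ℕ) : ∀ (P : Profile C V), P.cands = Q.cands →
    (∀ L, IsStrictLinearOrderOn Q.cands L → cnt P L = n * cnt Q L + k) →
    F.winners P = F.winners Q := by
  have hd : ∀ P : Profile C V, P.cands.card ≤ 4 → P ∈ F.dom := by
    intro P hP; rw [hdom]; exact hP
  induction k with
  | zero =>
    intro P hPQ h
    refine hH Q (hd _ hQ) P (hd _ (hPQ ▸ hQ)) n hn (isCopy_of_cnt _ _ _ hPQ ?_)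
    intro L
    by_cases hL : IsStrictLinearOrderOn Q.cands L
    · simpa using h L hL
    · rw [cnt_eq_zero _ _ hL, cnt_eq_zero _ _ (hPQ ▸ hL)]; simp
  | succ k ih =>
    intro P hPQ h
    obtain ⟨P', hc, hP'⟩ := exists_cancel P (by
      intro L hL; rw [h L (hPQ ▸ hL)]; omega)
    have h1 : P'.cands = Q.cands := hc.1.trans hPQ
    rw [← hC P (hd _ (hPQ ▸ hQ)) P' (hd _ (h1 ▸ hQ)) hc]
    refine ih P' h1 ?_
    intro L hL
    have := h L hL
    have := hP' L (hPQ ▸ hL)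
    omega

/-! Concrete profiles -/

def key {n : ℕ} (o : List (Fin n)) (i : Fin n) : ℕ := o.idxOf i * n + i.val

def lt {n : ℕ} (o : List (Fin n)) (i j : Fin n) : Bool := Nat.blt (key o i) (key o j)

theorem lt_iff {n : ℕ} (o : List (Fin n)) (i j : Fin n) : lt o i j = true ↔ key o i < key o j := by
  simp [lt, Nat.blt_eq]

theorem key_inj {n : ℕ} (o : List (Fin n)) {i j : Fin n} (h : key o i = key o j) : i = j := by
  have h1 : key o i % n = i.val := by
    simp [key, Nat.mod_eq_of_lt i.2]
  have h2 : key o j % n = j.val := by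
    simp [key, Nat.mod_eq_of_lt j.2]
  apply Fin.ext
  rw [← h1, ← h2, h]

def rel {n : ℕ} (f : Fin n → C) (o : List (Fin n)) : C → C → Prop :=
  fun x y => ∃ i j, f i = x ∧ f j = y ∧ lt o i j = true

theorem rel_iff {n : ℕ} {f : Fin n → C} (hf : Function.Injective f) (o : List (Fin n))
    (i j : Fin n) : rel f o (f i) (f j) ↔ lt o i j = true := by
  constructor
  · rintro ⟨i', j', h1, h2, h3⟩
    rw [hf h1, hf h2] at h3; exact h3
  · intro h; exact ⟨i, j, rfl, rfl, h⟩

theorem rel_lin {n : ℕ} {f : Fin n → C} (hf : Function.Injective f) (o : List (Fin n)) :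
    IsStrictLinearOrderOn (Finset.univ.image f) (rel f o) := by
  refine ⟨?_, ?_, ?_, ?_⟩
  · rintro x ⟨i, j, rfl, h2, h3⟩
    rw [hf h2, lt_iff] at h3
    omega
  · rintro x y z ⟨i, j, rfl, rfl, h3⟩ ⟨j', k, h4, rfl, h5⟩
    rw [hf h4] at h5
    rw [lt_iff] at h3 h5
    exact ⟨i, k, rfl, rfl, by rw [lt_iff]; omega⟩
  · intro x hx y hy hne
    obtain ⟨i, _, rfl⟩ := Finset.mem_image.mp hx
    obtain ⟨j, _, rfl⟩ := Finset.mem_image.mp hy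
    rw [rel_iff hf, rel_iff hf, lt_iff, lt_iff]
    have : key o i ≠ key o j := fun h => hne (by rw [key_inj o h])
    omega
  · rintro x y ⟨i, j, rfl, rfl, _⟩
    simp

def expand {α : Type} : List (ℕ × α) → List α
  | [] => []
  | d :: D => List.replicate d.1 d.2 ++ expand D

def ws {α : Type} : List (ℕ × α) → (α → ℕ) → ℕ
  | [], _ => 0
  | d :: D, g => d.1 * g d.2 + ws D g

theorem ws_eq {α : Type} (D : List (ℕ × α)) (g : α → ℕ) : ((expand D).map g).sum = ws D g := by
  induction D with
  | nil => simp [expand, ws]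
  | cons d D ih => simp [expand, ws, ih]

theorem sum_getD {α : Type} (E : List α) (a : α) (g : α → ℕ) :
    ∑ m ∈ Finset.range E.length, g (E.getD m a) = (E.map g).sum := by
  induction E with
  | nil => simp
  | cons o E ih =>
    rw [List.length_cons, Finset.sum_range_succ']
    simp only [List.getD_cons_succ, List.getD_cons_zero, List.map_cons, List.sum_cons]
    rw [ih, add_comm]

def mkP (v : ℕ ↪ V) {n : ℕ} [NeZero n] (f : Fin n → C) (hf : Function.Injective f)
    (D : List (ℕ × List (Fin n))) : Profile C V where
  voters := (Finset.range (expand D).length).map v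
  cands := Finset.univ.image f
  cands_nonempty := ⟨f 0, by simp⟩
  ballot := fun k => rel f ((expand D).getD (Function.invFun v k) [])
  ballot_lin := fun _ _ => rel_lin hf _

theorem sum_mkP (v : ℕ ↪ V) {n : ℕ} [NeZero n] (f : Fin n → C) (hf : Function.Injective f)
    (D : List (ℕ × List (Fin n))) (g : (C → C → Prop) → ℕ) :
    ∑ i ∈ (mkP v f hf D).voters, g ((mkP v f hf D).ballot i) = ws D (fun o => g (rel f o)) := by
  simp only [mkP, Finset.sum_map, Function.leftInverse_invFun v.injective _]
  rw [sum_getD (expand D) [] (fun o => g (rel f o)), ws_eq]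

def c {α : Type} (D : List (ℕ × α)) (p : α → Bool) : ℕ := ws D (fun o => (p o).toNat)

theorem card_mkP (v : ℕ ↪ V) {n : ℕ} [NeZero n] (f : Fin n → C) (hf : Function.Injective f)
    (D : List (ℕ × List (Fin n))) (q : (C → C → Prop) → Prop) [DecidablePred q] (p : List (Fin n) → Bool)
    (hp : ∀ o, q (rel f o) ↔ p o = true) :
    ((mkP v f hf D).voters.filter (fun i => q ((mkP v f hf D).ballot i))).card = c D p := by
  rw [Finset.card_filter, sum_mkP v f hf D (fun L => if q L then 1 else 0)]
  unfold c
  congr 1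
  funext o
  by_cases h : p o = true
  · simp [hp, h]
  · simp [hp, h]

theorem margin_mkP (v : ℕ ↪ V) {n : ℕ} [NeZero n] (f : Fin n → C) (hf : Function.Injective f)
    (D : List (ℕ × List (Fin n))) (i j : Fin n) :
    (mkP v f hf D).margin (f i) (f j) =
      (c D (fun o => lt o i j) : ℤ) - (c D (fun o => lt o j i) : ℤ) := by
  unfold Profile.margin
  rw [card_mkP v f hf D (fun L => L (f i) (f j)) (fun o => lt o i j) (fun o => rel_iff hf o i j),
    card_mkP v f hf D (fun L => L (f j) (f i)) (fun o => lt o j i) (fun o => rel_iff hf o j i)]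

def UW {n : ℕ} (D : List (ℕ × List (Fin n))) : Prop :=
  ∀ a b x y : Fin n, a ≠ b → x ≠ y → ¬ (a = x ∧ b = y) →
    c D (fun o => lt o a b) + c D (fun o => lt o y x) ≠
      c D (fun o => lt o x y) + c D (fun o => lt o b a)

def above {n : ℕ} (Y : Finset (Fin n)) (o : List (Fin n)) (x : Fin n) : ℕ :=
  (Y.filter (fun z => lt o z x = true)).card

def below {n : ℕ} (Y : Finset (Fin n)) (o : List (Fin n)) (x : Fin n) : ℕ :=
  (Y.filter (fun z => lt o x z = true)).card

def UR {n : ℕ} (D : List (ℕ × List (Fin n))) : Prop :=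
  ∀ Y : Finset (Fin n), 2 ≤ Y.card → ∀ x ∈ Y, ∀ y ∈ Y, x ≠ y →
    (∀ m < Y.card, c D (fun o => Nat.beq (above Y o x) m) ≠ c D (fun o => Nat.beq (above Y o y) m)) ∧
    ws D (fun o => below Y o x) ≠ ws D (fun o => below Y o y)

instance {n : ℕ} (D : List (ℕ × List (Fin n))) : Decidable (UW D) := by
  unfold UW; infer_instance

instance {n : ℕ} (D : List (ℕ × List (Fin n))) : Decidable (UR D) := by
  unfold UR; infer_instance

theorem uw_mkP (v : ℕ ↪ V) {n : ℕ} [NeZero n] (f : Fin n → C) (hf : Function.Injective f)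
    (D : List (ℕ × List (Fin n))) (h : UW D) : (mkP v f hf D).UniquelyWeighted := by
  intro a ha b hb x hx y hy hab hxy hne
  obtain ⟨a, _, rfl⟩ := Finset.mem_image.mp ha
  obtain ⟨b, _, rfl⟩ := Finset.mem_image.mp hb
  obtain ⟨x, _, rfl⟩ := Finset.mem_image.mp hx
  obtain ⟨y, _, rfl⟩ := Finset.mem_image.mp hy
  rw [margin_mkP, margin_mkP]
  have := h a b x y (fun h => hab (by rw [h])) (fun h => hxy (by rw [h]))
    (fun h => hne (by rw [h.1, h.2]))
  omega

theorem card_image_filter {n : ℕ} {f : Fin n → C} (hf : Function.Injective f)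
    (Y : Finset (Fin n)) (q : C → Prop) (p : Fin n → Bool) (h : ∀ i, q (f i) ↔ p i = true) :
    ((Y.image f).filter q).card = (Y.filter (fun z => p z = true)).card := by
  rw [Finset.filter_image, Finset.card_image_of_injective _ hf]
  simp only [h]

theorem ur_mkP (v : ℕ ↪ V) {n : ℕ} [NeZero n] (f : Fin n → C) (hf : Function.Injective f)
    (D : List (ℕ × List (Fin n))) (h : UR D) : (mkP v f hf D).UniquelyRanked := by
  intro Y hY hc
  obtain ⟨Y, rfl⟩ : ∃ Y' : Finset (Fin n), Y = Y'.image f := by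
    refine ⟨Finset.univ.filter (fun i => f i ∈ Y), ?_⟩
    ext x
    simp only [Finset.mem_image, Finset.mem_filter, Finset.mem_univ, true_and]
    constructor
    · intro hx
      obtain ⟨i, _, rfl⟩ := Finset.mem_image.mp (hY hx)
      exact ⟨i, hx, rfl⟩
    · rintro ⟨i, hi, rfl⟩; exact hi
  rw [Finset.card_image_of_injective _ hf] at hc ⊢
  have hab : ∀ o x, ((Y.image f).filter (fun z => rel f o z (f x))).card = above Y o x :=
    fun o x => card_image_filter hf Y _ _ (fun i => rel_iff hf o i x)
  have hbe : ∀ o x, ((Y.image f).filter (fun z => rel f o (f x) z)).card = below Y o x :=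
    fun o x => card_image_filter hf Y _ _ (fun i => rel_iff hf o x i)
  refine ⟨?_, ?_⟩
  · intro m hm1 hm2 x hx y hy hxy
    obtain ⟨x, hx', rfl⟩ := Finset.mem_image.mp hx
    obtain ⟨y, hy', rfl⟩ := Finset.mem_image.mp hy
    have := (h Y hc x hx' y hy' (fun h => hxy (by rw [h]))).1 (m - 1) (by omega)
    rw [card_mkP v f hf D (fun L => ((Y.image f).filter (fun z => L z (f x))).card = m - 1)
      (fun o => Nat.beq (above Y o x) (m - 1)) (fun o => by rw [hab]; simp),
      card_mkP v f hf D (fun L => ((Y.image f).filter (fun z => L z (f y))).card = m - 1)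
      (fun o => Nat.beq (above Y o y) (m - 1)) (fun o => by rw [hab]; simp)]
    exact this
  · intro x hx y hy hxy
    obtain ⟨x, hx', rfl⟩ := Finset.mem_image.mp hx
    obtain ⟨y, hy', rfl⟩ := Finset.mem_image.mp hy
    have := (h Y hc x hx' y hy' (fun h => hxy (by rw [h]))).2
    rw [sum_mkP v f hf D (fun L => ((Y.image f).filter (fun z => L (f x) z)).card),
      sum_mkP v f hf D (fun L => ((Y.image f).filter (fun z => L (f y) z)).card)]
    simp only [hbe]
    exact this

/-! Neutrality -/

theorem profile_ext (P Q : Profile C V) (h1 : P.voters = Q.voters) (h2 : P.cands = Q.cands)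
    (h3 : P.ballot = Q.ballot) : P = Q := by
  cases P; cases Q
  simp only at h1 h2 h3
  subst h1 h2 h3
  rfl

theorem mkP_swap (v : ℕ ↪ V) {n : ℕ} [NeZero n] (f : Fin n → C) (hf : Function.Injective f)
    (D : List (ℕ × List (Fin n))) (a b : C) :
    mkP v (Equiv.swap a b ∘ f) ((Equiv.swap a b).injective.comp hf) D =
      (mkP v f hf D).swapCands a b := by
  refine profile_ext _ _ rfl ?_ ?_
  · simp only [mkP, Profile.swapCands]
    rw [Finset.image_image]
  · funext k x y
    simp only [mkP, Profile.swapCands, swapRel, rel, Function.comp, Equiv.swap_apply_eq_iff]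

theorem reach {n : ℕ} (T : (Fin n → C) → Prop)
    (hT : ∀ f, Function.Injective f → T f → ∀ a b : C, T (Equiv.swap a b ∘ f))
    (f g : Fin n → C) (hf : Function.Injective f) (hg : Function.Injective g) (h : T f) : T g := by
  have main : ∀ k ≤ n, ∃ f' : Fin n → C, Function.Injective f' ∧ T f' ∧
      ∀ i : Fin n, i.val < k → f' i = g i := by
    intro k
    induction k with
    | zero => intro _; exact ⟨f, hf, h, fun i hi => absurd hi (by omega)⟩
    | succ k ih =>
      intro hk
      obtain ⟨f', h1, h2, h3⟩ := ih (by omega)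
      let t : Fin n := ⟨k, by omega⟩
      refine ⟨Equiv.swap (f' t) (g t) ∘ f', (Equiv.swap _ _).injective.comp h1,
        hT f' h1 h2 _ _, ?_⟩
      intro i hi
      by_cases hit : i = t
      · subst hit; simp
      · have hlt : i.val < k := by
          have : i.val ≠ k := fun h => hit (Fin.ext h)
          omega
        have h4 : f' i ≠ f' t := fun h => hit (h1 h)
        have h5 : f' i ≠ g t := by rw [h3 i hlt]; exact fun h => hit (hg h)
        simp only [Function.comp]
        rw [Equiv.swap_apply_of_ne_of_ne h4 h5, h3 i hlt]
  obtain ⟨f', _, h2, h3⟩ := main n le_rfl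
  have : f' = g := funext fun i => h3 i i.2
  exact this ▸ h2

/-! Comparing restrictions -/

theorem lin_ext {n : ℕ} {f : Fin n → C} {L L' : C → C → Prop}
    (hf : Function.Injective f)
    (hL : IsStrictLinearOrderOn (Finset.univ.image f) L)
    (hL' : IsStrictLinearOrderOn (Finset.univ.image f) L')
    (h : ∀ i j : Fin n, i < j → (L (f i) (f j) ↔ L' (f i) (f j))) : L = L' := by
  have asym : ∀ {M : C → C → Prop}, IsStrictLinearOrderOn (Finset.univ.image f) M →
      ∀ i j : Fin n, i ≠ j → (M (f j) (f i) ↔ ¬ M (f i) (f j)) := by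
    intro M hM i j hij
    constructor
    · intro h1 h2; exact hM.1 _ (hM.2.1 _ _ _ h1 h2)
    · intro h1
      rcases hM.2.2.1 (f i) (by simp) (f j) (by simp) (fun h => hij (hf h)) with h2 | h2
      · exact absurd h2 h1
      · exact h2
  have all : ∀ i j : Fin n, L (f i) (f j) ↔ L' (f i) (f j) := by
    intro i j
    rcases lt_trichotomy i j with hij | rfl | hij
    · exact h i j hij
    · exact ⟨fun h => absurd h (hL.1 _), fun h => absurd h (hL'.1 _)⟩
    · rw [asym hL j i hij.ne, asym hL' j i hij.ne, h j i hij]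
  funext x y
  apply propext
  constructor
  · intro hxy
    obtain ⟨hx, hy⟩ := hL.2.2.2 _ _ hxy
    obtain ⟨i, _, rfl⟩ := Finset.mem_image.mp hx
    obtain ⟨j, _, rfl⟩ := Finset.mem_image.mp hy
    exact (all i j).1 hxy
  · intro hxy
    obtain ⟨hx, hy⟩ := hL'.2.2.2 _ _ hxy
    obtain ⟨i, _, rfl⟩ := Finset.mem_image.mp hx
    obtain ⟨j, _, rfl⟩ := Finset.mem_image.mp hy
    exact (all i j).2 hxy

theorem cnt_restrict (v : ℕ ↪ V) {n m : ℕ} [NeZero n] (e : Fin n → C) (he : Function.Injective e)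
    (D : List (ℕ × List (Fin n))) (u : Fin m → Fin n) (hu : Function.Injective u)
    (A : Finset C) (hA : A = Finset.univ.image (e ∘ u)) (hne : A.Nonempty)
    (hs : A ⊆ (mkP v e he D).cands)
    (L : C → C → Prop) (hL : IsStrictLinearOrderOn A L) (p : List (Fin n) → Bool)
    (hp : ∀ o, p o = true ↔
      ∀ i j : Fin m, i < j → (lt o (u i) (u j) = true ↔ L (e (u i)) (e (u j)))) :
    cnt ((mkP v e he D).restrict A hne hs) L = c D p := by
  subst hA
  unfold cnt
  refine card_mkP v e he D (fun M => restrictRel (Finset.univ.image (e ∘ u)) M = L) p ?_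
  intro o
  rw [hp]
  constructor
  · intro h i j hij
    rw [← h, ← rel_iff he]
    simp [restrictRel]
  · intro h
    refine lin_ext (he.comp hu) ((rel_lin he o).restrict hs) hL ?_
    intro i j hij
    rw [Function.comp, Function.comp, ← h i j hij, ← rel_iff he]
    simp [restrictRel]

theorem cnt_mkP (v : ℕ ↪ V) {n : ℕ} [NeZero n] (f : Fin n → C) (hf : Function.Injective f)
    (D : List (ℕ × List (Fin n)))
    (L : C → C → Prop) (hL : IsStrictLinearOrderOn (Finset.univ.image f) L)
    (p : List (Fin n) → Bool)
    (hp : ∀ o, p o = true ↔ ∀ i j : Fin n, i < j → (lt o i j = true ↔ L (f i) (f j))) :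
    cnt (mkP v f hf D) L = c D p := by
  unfold cnt
  refine card_mkP v f hf D (fun M => M = L) p ?_
  intro o
  rw [hp]
  constructor
  · rintro rfl i j hij
    rw [rel_iff hf]
  · intro h
    refine lin_ext hf (rel_lin hf o) hL ?_
    intro i j hij
    rw [← h i j hij, ← rel_iff hf]

def pat2 {n : ℕ} (u : Fin 2 → Fin n) (b : Bool) (o : List (Fin n)) : Bool :=
  lt o (u 0) (u 1) == b

def pat3 {n : ℕ} (u : Fin 3 → Fin n) (b1 b2 b3 : Bool) (o : List (Fin n)) : Bool :=
  (lt o (u 0) (u 1) == b1) && (lt o (u 0) (u 2) == b2) && (lt o (u 1) (u 2) == b3)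

theorem pat2_iff {n : ℕ} (u : Fin 2 → Fin n) (o : List (Fin n)) (g : Fin 2 → C)
    (L : C → C → Prop) :
    pat2 u (decide (L (g 0) (g 1))) o = true ↔
      ∀ i j : Fin 2, i < j → (lt o (u i) (u j) = true ↔ L (g i) (g j)) := by
  simp only [pat2, Fin.forall_fin_two, beq_iff_eq]
  by_cases h : L (g 0) (g 1) <;> simp [h]

theorem pat3_iff {n : ℕ} (u : Fin 3 → Fin n) (o : List (Fin n)) (g : Fin 3 → C)
    (L : C → C → Prop) :
    pat3 u (decide (L (g 0) (g 1))) (decide (L (g 0) (g 2))) (decide (L (g 1) (g 2))) o = true ↔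
      ∀ i j : Fin 3, i < j → (lt o (u i) (u j) = true ↔ L (g i) (g j)) := by
  simp only [pat3, Bool.and_eq_true, beq_iff_eq]
  constructor
  · rintro ⟨⟨h1, h2⟩, h3⟩ i j hij
    fin_cases i <;> fin_cases j <;> first | (exact absurd hij (by decide)) | simp [h1, h2, h3]
  · intro h
    have h1 := h 0 1 (by decide)
    have h2 := h 0 2 (by decide)
    have h3 := h 1 2 (by decide)
    have aux : ∀ (b : Bool) (q : Prop), (b = true ↔ q) → b = decide q := by
      intro b q hb
      by_cases hq : q <;> simp [hq] at hb ⊢ <;> exact hb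
    exact ⟨⟨aux _ _ h1, aux _ _ h2⟩, aux _ _ h3⟩

def chk3 (R : List (ℕ × List (Fin 3))) (D : List (ℕ × List (Fin 4))) (u : Fin 3 → Fin 4)
    (n k : ℕ) : Prop :=
  ∀ b1 b2 b3 : Bool, (b1 = b3 → b2 = b1) →
    c D (pat3 u b1 b2 b3) = n * c R (pat3 id b1 b2 b3) + k

instance (R : List (ℕ × List (Fin 3))) (D : List (ℕ × List (Fin 4))) (u : Fin 3 → Fin 4)
    (n k : ℕ) : Decidable (chk3 R D u n k) := by
  unfold chk3; infer_instance

def dataR : List (ℕ × List (Fin 3)) :=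
  [(6, [0, 1, 2]),
   (2, [1, 2, 0]),
   (5, [2, 0, 1]),
   (2, [2, 1, 0])]

def dataA0 : List (ℕ × List (Fin 4)) :=
  [(4, [0, 2, 3, 1]),
   (2, [0, 2, 1, 3]),
   (5, [0, 1, 2, 3]),
   (5, [0, 1, 3, 2]),
   (3, [2, 0, 1, 3]),
   (2, [2, 0, 3, 1]),
   (3, [1, 2, 3, 0]),
   (4, [2, 3, 0, 1]),
   (10, [1, 3, 0, 2]),
   (5, [1, 3, 2, 0]),
   (2, [3, 2, 0, 1])]

def dataA1 : List (ℕ × List (Fin 4)) :=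
  [(10, [0, 1, 3, 2]),
   (13, [0, 1, 2, 3]),
   (3, [0, 2, 1, 3]),
   (16, [2, 0, 1, 3]),
   (11, [3, 1, 0, 2]),
   (14, [3, 0, 1, 2]),
   (3, [3, 0, 2, 1]),
   (2, [1, 3, 2, 0]),
   (5, [3, 2, 0, 1]),
   (1, [3, 2, 1, 0]),
   (2, [3, 1, 2, 0]),
   (10, [1, 2, 3, 0]),
   (13, [2, 3, 0, 1]),
   (2, [2, 1, 3, 0])]

def dataA2 : List (ℕ × List (Fin 4)) :=
  [(15, [0, 2, 3, 1]),
   (10, [1, 0, 2, 3]),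
   (9, [0, 1, 2, 3]),
   (1, [0, 2, 1, 3]),
   (7, [1, 0, 3, 2]),
   (7, [0, 1, 3, 2]),
   (21, [2, 3, 0, 1]),
   (15, [1, 2, 3, 0]),
   (1, [2, 1, 3, 0]),
   (5, [2, 3, 1, 0]),
   (4, [1, 3, 0, 2]),
   (10, [3, 1, 0, 2])]

def dataB0 : List (ℕ × List (Fin 4)) :=
  [(13, [1, 0, 3, 2]),
   (8, [0, 3, 2, 1]),
   (15, [1, 0, 2, 3]),
   (12, [2, 1, 0, 3]),
   (6, [2, 0, 3, 1]),
   (2, [1, 2, 0, 3]),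
   (5, [3, 0, 2, 1]),
   (10, [3, 1, 0, 2]),
   (12, [3, 2, 1, 0]),
   (5, [3, 2, 0, 1]),
   (4, [2, 3, 0, 1]),
   (13, [2, 3, 1, 0])]

def dataB1 : List (ℕ × List (Fin 4)) :=
  [(5, [2, 1, 0, 3]),
   (6, [2, 0, 3, 1]),
   (6, [2, 0, 1, 3]),
   (1, [1, 2, 0, 3]),
   (3, [0, 3, 2, 1]),
   (1, [1, 0, 3, 2]),
   (1, [0, 1, 3, 2]),
   (1, [0, 3, 1, 2]),
   (5, [3, 2, 1, 0]),
   (4, [3, 2, 0, 1]),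
   (4, [1, 3, 2, 0]),
   (2, [3, 1, 2, 0]),
   (1, [3, 0, 2, 1]),
   (4, [3, 1, 0, 2]),
   (1, [1, 3, 0, 2])]

def dataB2 : List (ℕ × List (Fin 4)) :=
  [(5, [2, 1, 0, 3]),
   (6, [2, 0, 3, 1]),
   (1, [1, 2, 0, 3]),
   (2, [2, 0, 1, 3]),
   (12, [1, 0, 3, 2]),
   (14, [0, 3, 2, 1]),
   (3, [0, 3, 1, 2]),
   (6, [0, 1, 3, 2]),
   (7, [1, 0, 2, 3]),
   (5, [0, 2, 3, 1]),
   (2, [0, 2, 1, 3]),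
   (14, [3, 2, 1, 0]),
   (2, [3, 1, 2, 0]),
   (10, [3, 2, 0, 1]),
   (16, [1, 3, 2, 0])]


def data2 : List (ℕ × List (Fin 2)) := [(1, [0, 1])]

theorem triple_eq [Nonempty V] (F : VotingMethod C V)
    (hdom : F.dom = {P : Profile C V | P.cands.card ≤ 4})
    (hH : F.Homogeneous) (hC : F.Cancellative) (v : ℕ ↪ V)
    (e : Fin 4 → C) (he : Function.Injective e) (D : List (ℕ × List (Fin 4)))
    (R : List (ℕ × List (Fin 3))) (u : Fin 3 → Fin 4) (hu : Function.Injective u)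
    (n k : ℕ) (hn : 0 < n) (hchk : chk3 R D u n k)
    (A : Finset C) (hA : A = Finset.univ.image (e ∘ u)) (hne : A.Nonempty)
    (hs : A ⊆ (mkP v e he D).cands) :
    F.winners ((mkP v e he D).restrict A hne hs) =
      F.winners (mkP v (e ∘ u) (he.comp hu) R) := by
  refine transfer F hdom hH hC _ ?_ n hn k _ hA ?_
  · exact le_trans Finset.card_image_le (by simp)
  · intro L hL
    rw [cnt_restrict v e he D u hu A hA hne hs L (by rw [hA]; exact hL)
        (pat3 u (decide (L (e (u 0)) (e (u 1)))) (decide (L (e (u 0)) (e (u 2))))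
          (decide (L (e (u 1)) (e (u 2)))))
        (fun o => pat3_iff u o (e ∘ u) L),
      cnt_mkP v (e ∘ u) (he.comp hu) R L hL
        (pat3 id (decide (L (e (u 0)) (e (u 1)))) (decide (L (e (u 0)) (e (u 2))))
          (decide (L (e (u 1)) (e (u 2)))))
        (fun o => pat3_iff id o (e ∘ u) L)]
    apply hchk
    intro h
    rw [decide_eq_decide] at h ⊢
    have hne3 : ∀ i j : Fin 3, i ≠ j → e (u i) ≠ e (u j) := fun i j hij h => hij (hu (he h))
    have hmem : ∀ i : Fin 3, e (u i) ∈ (mkP v (e ∘ u) (he.comp hu) R).cands := by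
      intro i; simp [mkP]
    obtain ⟨hirr, htr, htot, -⟩ := hL
    constructor
    · intro h02
      by_contra h01
      have h12 := fun h' => h01 (h.2 h')
      have h10 := (htot _ (hmem 0) _ (hmem 1) (hne3 0 1 (by decide))).resolve_left h01
      exact h12 (htr _ _ _ h10 h02)
    · intro h01
      exact htr _ _ _ h01 (h.1 h01)

theorem pair_eq [Nonempty V] (F : VotingMethod C V)
    (hdom : F.dom = {P : Profile C V | P.cands.card ≤ 4})
    (hH : F.Homogeneous) (hC : F.Cancellative) (v : ℕ ↪ V)
    (e : Fin 4 → C) (he : Function.Injective e) (D : List (ℕ × List (Fin 4)))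
    (u : Fin 2 → Fin 4) (hu : Function.Injective u)
    (hchk : c D (pat2 u false) < c D (pat2 u true))
    (A : Finset C) (hA : A = Finset.univ.image (e ∘ u)) (hne : A.Nonempty)
    (hs : A ⊆ (mkP v e he D).cands) :
    F.winners ((mkP v e he D).restrict A hne hs) =
      F.winners (mkP v (e ∘ u) (he.comp hu) data2) := by
  refine transfer F hdom hH hC _ ?_ (c D (pat2 u true) - c D (pat2 u false)) (by omega)
    (c D (pat2 u false)) _ hA ?_
  · exact le_trans Finset.card_image_le (by simp)
  · intro L hL
    rw [cnt_restrict v e he D u hu A hA hne hs L (by rw [hA]; exact hL)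
        (pat2 u (decide (L (e (u 0)) (e (u 1))))) (fun o => pat2_iff u o (e ∘ u) L),
      cnt_mkP v (e ∘ u) (he.comp hu) data2 L hL
        (pat2 id (decide (L (e (u 0)) (e (u 1))))) (fun o => pat2_iff id o (e ∘ u) L)]
    have h1 : c data2 (pat2 id true) = 1 := by decide +kernel
    have h0 : c data2 (pat2 id false) = 0 := by decide +kernel
    by_cases h : L (e (u 0)) (e (u 1))
    · simp only [h, decide_true, h1]; omega
    · simp only [h, decide_false, h0]; omega

theorem glue [Nonempty V] (F : VotingMethod C V)
    (hdom : F.dom = {P : Profile C V | P.cands.card ≤ 4})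
    (hH : F.Homogeneous) (hC : F.Cancellative) (hG : F.BinaryGamma) (v : ℕ ↪ V)
    (e : Fin 4 → C) (he : Function.Injective e) (D : List (ℕ × List (Fin 4)))
    (R : List (ℕ × List (Fin 3))) (u : Fin 3 → Fin 4) (hu : Function.Injective u)
    (i : Fin 3) (hwin : ∀ f (hf : Function.Injective f), f i ∈ F.winners (mkP v f hf R))
    (n k : ℕ) (hn : 0 < n) (hchk : chk3 R D u n k)
    (y : Fin 4) (hy : ∀ z, z ≠ y ↔ ∃ j, u j = z)
    (w : Fin 2 → Fin 4) (hw : Function.Injective w)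
    (s : Fin 2) (hs : w s = u i) (hwy : ∀ t, w t = u i ∨ w t = y) (hwy' : ∃ t, w t = y)
    (hpc : c D (pat2 w false) < c D (pat2 w true))
    (hpair : ∀ f (hf : Function.Injective f), F.winners (mkP v f hf data2) = {f s}) :
    e (u i) ∈ F.winners (mkP v e he D) := by
  have hd : ∀ P : Profile C V, P.cands.card ≤ 4 → P ∈ F.dom := by
    intro P hP; rw [hdom]; exact hP
  have hcard : (mkP v e he D).cands.card ≤ 4 := le_trans Finset.card_image_le (by simp)
  have hxm : ∀ x, e x ∈ (mkP v e he D).cands := by intro x; simp [mkP]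
  have hne : u i ≠ y := (hy _).2 ⟨i, rfl⟩
  have herase : (mkP v e he D).cands.erase (e y) = Finset.univ.image (e ∘ u) := by
    ext x
    simp only [mkP, Finset.mem_erase, Finset.mem_image, Finset.mem_univ, true_and, Function.comp]
    constructor
    · rintro ⟨h1, z, rfl⟩
      obtain ⟨j, rfl⟩ := (hy z).1 (fun h => h1 (by rw [h]))
      exact ⟨j, rfl⟩
    · rintro ⟨j, rfl⟩
      exact ⟨fun h => (hy (u j)).2 ⟨j, rfl⟩ (he h), u j, rfl⟩
  have hpairset : ({e (u i), e y} : Finset C) = Finset.univ.image (e ∘ w) := by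
    ext x
    simp only [Finset.mem_insert, Finset.mem_singleton, Finset.mem_image, Finset.mem_univ,
      true_and, Function.comp]
    constructor
    · rintro (rfl | rfl)
      · exact ⟨s, by rw [hs]⟩
      · obtain ⟨t, ht⟩ := hwy'
        exact ⟨t, by rw [ht]⟩
    · rintro ⟨t, rfl⟩
      rcases hwy t with h | h
      · left; rw [h]
      · right; rw [h]
  refine hG _ (hd _ hcard) (e (u i)) (hxm _) (e y) (hxm _) (fun h => hne (he h))
    ⟨e (u i), by rw [herase]; simp⟩ (hd _ ?_) (hd _ ?_) ?_ ?_
  · exact le_trans (Finset.card_le_card (Finset.erase_subset _ _)) hcard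
  · exact le_trans Finset.card_le_two (by norm_num)
  · have h1 := triple_eq F hdom hH hC v e he D R u hu n k hn hchk _ herase
      ⟨e (u i), by rw [herase]; simp⟩ (Finset.erase_subset _ _)
    have h2 := hwin (e ∘ u) (he.comp hu)
    rw [← h1] at h2
    exact h2
  · have h1 := pair_eq F hdom hH hC v e he D w hw hpc _ hpairset
      ⟨e (u i), Finset.mem_insert_self _ _⟩ (by
        intro z hz
        rcases Finset.mem_insert.mp hz with rfl | hz
        · exact hxm _
        · rw [Finset.mem_singleton.mp hz]; exact hxm _)
    rw [hpair (e ∘ w) (he.comp hw)] at h1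
    have h2 : (e ∘ w) s = e (u i) := by simp [hs]
    rw [h2] at h1
    exact h1

theorem contra [Nonempty V] (F : VotingMethod C V)
    (hdom : F.dom = {P : Profile C V | P.cands.card ≤ 4})
    (hH : F.Homogeneous) (hC : F.Cancellative) (hG : F.BinaryGamma) (hW : F.WeakQuasiResolute)
    (v : ℕ ↪ V) (e : Fin 4 → C) (he : Function.Injective e) (D : List (ℕ × List (Fin 4)))
    (i : Fin 3) (hwin : ∀ f (hf : Function.Injective f), f i ∈ F.winners (mkP v f hf dataR))
    (s : Fin 2)
    (hpair : ∀ f (hf : Function.Injective f), F.winners (mkP v f hf data2) = {f s})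
    (u₁ u₂ : Fin 3 → Fin 4) (n₁ k₁ n₂ k₂ : ℕ) (w₁ w₂ : Fin 2 → Fin 4)
    (hall : UW D ∧ UR D ∧ chk3 dataR D u₁ n₁ k₁ ∧ chk3 dataR D u₂ n₂ k₂ ∧
      0 < n₁ ∧ 0 < n₂ ∧ (∀ a b, u₁ a = u₁ b → a = b) ∧ (∀ a b, u₂ a = u₂ b → a = b) ∧
      (∀ a b, w₁ a = w₁ b → a = b) ∧ (∀ a b, w₂ a = w₂ b → a = b) ∧
      u₁ i = 0 ∧ u₂ i = 1 ∧ (∀ z, z ≠ 1 ↔ ∃ j, u₁ j = z) ∧ (∀ z, z ≠ 2 ↔ ∃ j, u₂ j = z) ∧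
      w₁ s = 0 ∧ w₂ s = 1 ∧ (∀ t, w₁ t = 0 ∨ w₁ t = 1) ∧ (∀ t, w₂ t = 1 ∨ w₂ t = 2) ∧
      (∃ t, w₁ t = 1) ∧ (∃ t, w₂ t = 2) ∧
      c D (pat2 w₁ false) < c D (pat2 w₁ true) ∧ c D (pat2 w₂ false) < c D (pat2 w₂ true)) :
    False := by
  obtain ⟨h1, h2, h3, h4, h5, h6, h7, h8, h9, h10, h11, h12, h13, h14, h15, h16, h17, h18,
    h19, h20, h21, h22⟩ := hall
  have ha := glue F hdom hH hC hG v e he D dataR u₁ h7 i hwin n₁ k₁ h5 h3 1 h13 w₁ h9 s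
    (h15.trans h11.symm) (by rw [h11]; exact h17) h19 h21 hpair
  have hb := glue F hdom hH hC hG v e he D dataR u₂ h8 i hwin n₂ k₂ h6 h4 2 h14 w₂ h10 s
    (h16.trans h12.symm) (by rw [h12]; exact h18) h20 h22 hpair
  rw [h11] at ha
  rw [h12] at hb
  have hone := hW (mkP v e he D)
    (by rw [hdom]; exact le_trans Finset.card_image_le (by simp))
    (uw_mkP v e he D h1) (ur_mkP v e he D h2)
  obtain ⟨x, hx⟩ := Finset.card_eq_one.mp hone
  rw [hx, Finset.mem_singleton] at ha hb
  have := he (ha.trans hb.symm)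
  exact absurd this (by decide)

end NHC

/-- There is no voting method on the domain of all profiles with at
most 4 candidates that is anonymous, neutral, homogeneous, and cancellative and
satisfies binary γ and weak quasi-resoluteness. -/
theorem no_homogeneous_cancellative_method (C V : Type) [Infinite C] [Infinite V] :
    ¬ ∃ F : VotingMethod C V,
      F.dom = {P : Profile C V | P.cands.card ≤ 4} ∧
      F.Anonymous ∧ F.Neutral ∧ F.Homogeneous ∧ F.Cancellative ∧
      F.BinaryGamma ∧ F.WeakQuasiResolute := by
  rintro ⟨F, hdom, -, hN, hH, hC, hG, hW⟩
  have : Nonempty V := inferInstance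
  let v : ℕ ↪ V := Infinite.natEmbedding V
  have hd : ∀ P : Profile C V, P.cands.card ≤ 4 → P ∈ F.dom := by
    intro P hP; rw [hdom]; exact hP
  have hcd : ∀ {n : ℕ} (f : Fin n → C), n ≤ 4 → (Finset.univ.image f).card ≤ 4 := by
    intro n f hn
    exact le_trans Finset.card_image_le (by simpa using hn)
  let ee : ∀ n : ℕ, Fin n → C := fun n i => Infinite.natEmbedding C i.val
  have hee : ∀ n, Function.Injective (ee n) := by
    intro n i j h
    exact Fin.ext ((Infinite.natEmbedding C).injective h)
  -- neutrality
  have hneut3 : ∀ i : Fin 3, (ee 3 i ∈ F.winners (NHC.mkP v (ee 3) (hee 3) NHC.dataR)) →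
      ∀ f (hf : Function.Injective f), f i ∈ F.winners (NHC.mkP v f hf NHC.dataR) := by
    intro i hi f hf
    refine NHC.reach (fun f => ∀ hf : Function.Injective f,
      f i ∈ F.winners (NHC.mkP v f hf NHC.dataR)) ?_ (ee 3) f (hee 3) hf (fun _ => hi) hf
    intro g hg h a b _
    rw [NHC.mkP_swap v g hg]
    have hsw := NHC.mkP_swap v g hg NHC.dataR a b
    rw [hN _ (hd _ (hcd g (by norm_num))) a b
      (hd _ (by rw [← hsw]; exact hcd _ (by norm_num)))]
    exact Finset.mem_image_of_mem _ (h hg)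
  have hneut2 : ∀ i : Fin 2, (F.winners (NHC.mkP v (ee 2) (hee 2) NHC.data2) = {ee 2 i}) →
      ∀ f (hf : Function.Injective f), F.winners (NHC.mkP v f hf NHC.data2) = {f i} := by
    intro i hi f hf
    refine NHC.reach (fun f => ∀ hf : Function.Injective f,
      F.winners (NHC.mkP v f hf NHC.data2) = {f i}) ?_ (ee 2) f (hee 2) hf (fun _ => hi) hf
    intro g hg h a b _
    rw [NHC.mkP_swap v g hg]
    have hsw := NHC.mkP_swap v g hg NHC.data2 a b
    rw [hN _ (hd _ (hcd g (by norm_num))) a b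
      (hd _ (by rw [← hsw]; exact hcd _ (by norm_num))), h hg]
    simp
  obtain ⟨i, hi⟩ : ∃ i : Fin 3, ee 3 i ∈ F.winners (NHC.mkP v (ee 3) (hee 3) NHC.dataR) := by
    have hm := hd (NHC.mkP v (ee 3) (hee 3) NHC.dataR) (hcd _ (by norm_num))
    obtain ⟨x, hx⟩ := F.winners_nonempty _ hm
    obtain ⟨i, _, rfl⟩ := Finset.mem_image.mp (F.winners_sub _ hm hx)
    exact ⟨i, hx⟩
  obtain ⟨s, hs⟩ : ∃ s : Fin 2, F.winners (NHC.mkP v (ee 2) (hee 2) NHC.data2) = {ee 2 s} := by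
    have hm := hd (NHC.mkP v (ee 2) (hee 2) NHC.data2) (hcd _ (by norm_num))
    have hone := hW _ hm (NHC.uw_mkP v _ _ _ (by decide +kernel))
      (NHC.ur_mkP v _ _ _ (by decide +kernel))
    obtain ⟨x, hx⟩ := Finset.card_eq_one.mp hone
    have hx' : x ∈ F.winners (NHC.mkP v (ee 2) (hee 2) NHC.data2) := by rw [hx]; simp
    obtain ⟨i, _, rfl⟩ := Finset.mem_image.mp (F.winners_sub _ hm hx')
    exact ⟨i, hx⟩
  have hwin := hneut3 i hi
  have hpair := hneut2 s hs
  have key := NHC.contra F hdom hH hC hG hW v (ee 4) (hee 4)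
  fin_cases s <;> fin_cases i
  · exact key NHC.dataA0 0 hwin 0 hpair ![0, 2, 3] ![1, 3, 0]
      1 5 3 0 ![0, 1] ![1, 2] (by decide +kernel)
  · exact key NHC.dataA1 1 hwin 0 hpair ![3, 0, 2] ![0, 1, 3]
      3 10 7 0 ![0, 1] ![1, 2] (by decide +kernel)
  · exact key NHC.dataA2 2 hwin 0 hpair ![2, 3, 0] ![3, 0, 1]
      7 0 1 15 ![0, 1] ![1, 2] (by decide +kernel)
  · exact key NHC.dataB0 0 hwin 1 hpair ![0, 3, 2] ![1, 0, 3]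
      1 15 7 0 ![1, 0] ![2, 1] (by decide +kernel)
  · exact key NHC.dataB1 1 hwin 1 hpair ![2, 0, 3] ![3, 1, 0]
      3 0 1 5 ![1, 0] ![2, 1] (by decide +kernel)
  · exact key NHC.dataB2 2 hwin 1 hpair ![3, 2, 0] ![0, 3, 1]
      7 0 3 10 ![1, 0] ![2, 1] (by decide +kernel)
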